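/- Let p ≥ 3 be a prime, let b, ε be integers with 1 ≤ b ≤ p − 2 and 0 ≤ ε ≤ p − 1, set n = bp + ε, and let a, m be integers with 1 ≤ a ≤ ε and m ≥ 1. Then Σ_{l=0}^{b} (−1)^l · (−l)^m · C(n, a + lp) / ((b+1)p − a − lp) ≡ (−1)^{b+m+1} · b! · {m brace b} · C(ε, a) / a mod p, as rational numbers. -/

import Mathlib

/-- Congruence of rational numbers modulo `p^k`. -/
def RatCong (p k : ℕ) (x y : ℚ) : Prop :=
  x = y ∨ (k : ℤ) ≤ padicValRat p (x - y)

/-- Stirling number of the second kind `{t brace s}` (with the convention `0^0 = 1`),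
viewed as a rational number. -/
def stir (t s : ℕ) : ℚ :=
  (1 / (Nat.factorial s : ℚ)) *
    ∑ j ∈ Finset.range (s + 1), (-1 : ℚ) ^ j * (s.choose j : ℚ) * ((s - j : ℕ) : ℚ) ^ t

def PGood (p : ℕ) (x : ℚ) : Prop := ∃ u v : ℤ, ¬ ((p : ℤ) ∣ v) ∧ x * v = p * u

lemma PGood.sum {p : ℕ} (hp : p.Prime) (s : Finset ℕ) (f : ℕ → ℚ) (h : ∀ i ∈ s, PGood p (f i)) :
    PGood p (∑ i ∈ s, f i) := by
  induction s using Finset.induction_on with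
  | empty =>
    refine ⟨0, 1, ?_, by simp⟩
    intro h1
    exact (Nat.prime_iff_prime_int.mp hp).not_unit (isUnit_of_dvd_one h1)
  | insert i s hi ih =>
    rw [Finset.sum_insert hi]
    obtain ⟨u, v, hv, e⟩ := h i (Finset.mem_insert_self _ _)
    obtain ⟨u', v', hv', e'⟩ := ih (fun j hj => h j (Finset.mem_insert_of_mem hj))
    refine ⟨u * v' + u' * v, v * v', ?_, ?_⟩
    · intro hd
      rcases (Nat.prime_iff_prime_int.mp hp).dvd_or_dvd hd with h1 | h1
      · exact hv h1
      · exact hv' h1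
    · push_cast
      linear_combination (v' : ℚ) * e + (v : ℚ) * e'

lemma PGood.ratCong {p : ℕ} (hp : p.Prime) {x y : ℚ} (h : PGood p (x - y)) : RatCong p 1 x y := by
  haveI := Fact.mk hp
  by_cases hxy : x = y
  · exact Or.inl hxy
  right
  obtain ⟨u, v, hv, e⟩ := h
  have hw : x - y ≠ 0 := sub_ne_zero.mpr hxy
  have hv0 : (v : ℚ) ≠ 0 := by
    intro h0
    have : v = 0 := by exact_mod_cast h0
    exact hv (this ▸ dvd_zero _)
  have hp0 : (p : ℚ) ≠ 0 := by exact_mod_cast hp.ne_zero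
  have hu0 : (u : ℚ) ≠ 0 := by
    intro h0
    rw [h0, mul_zero] at e
    exact (mul_ne_zero hw hv0) e
  have e2 := congrArg (padicValRat p) e
  rw [padicValRat.mul hw hv0, padicValRat.mul hp0 hu0, padicValRat.of_int, padicValRat.of_int,
    padicValInt.eq_zero_of_not_dvd hv, padicValRat.self hp.one_lt] at e2
  push_cast at e2 ⊢
  have : (0 : ℤ) ≤ (padicValInt p u : ℤ) := Int.natCast_nonneg _
  linarith

lemma choose_lucas_aux {p : ℕ} (hp : p.Prime) (b ε a l : ℕ) (hε : ε < p) (ha : a < p) :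
    ∃ k : ℤ, ((b * p + ε).choose (a + l * p) : ℤ) = b.choose l * ε.choose a + p * k := by
  haveI := Fact.mk hp
  have h := Choose.choose_modEq_choose_mod_mul_choose_div (p := p) (n := b * p + ε) (k := a + l * p)
  have h1 : (b * p + ε) % p = ε := by
    rw [mul_comm, Nat.mul_add_mod, Nat.mod_eq_of_lt hε]
  have h2 : (b * p + ε) / p = b := by
    rw [mul_comm, Nat.mul_add_div hp.pos, Nat.div_eq_of_lt hε, add_zero]
  have h3 : (a + l * p) % p = a := by
    rw [Nat.add_mul_mod_self_right, Nat.mod_eq_of_lt ha]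
  have h4 : (a + l * p) / p = l := by
    rw [Nat.add_mul_div_right _ _ hp.pos, Nat.div_eq_of_lt ha, zero_add]
  rw [h1, h2, h3, h4] at h
  obtain ⟨k, hk⟩ := h.symm.dvd
  exact ⟨k, by push_cast at hk; linear_combination hk⟩

lemma stir_aux (b m : ℕ) : (-1 : ℚ) ^ (b + m + 1) * (b.factorial : ℚ) * stir m b
    = ∑ l ∈ Finset.range (b + 1), -((-1 : ℚ) ^ l * (-(l : ℚ)) ^ m * (b.choose l : ℚ)) := by
  have hf : (b.factorial : ℚ) ≠ 0 := by exact_mod_cast b.factorial_ne_zero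
  unfold stir
  rw [show ∀ S : ℚ, (-1 : ℚ) ^ (b + m + 1) * (b.factorial : ℚ) * (1 / (b.factorial : ℚ) * S)
    = (-1 : ℚ) ^ (b + m + 1) * S from fun S => by field_simp]
  rw [← Finset.sum_range_reflect, Finset.mul_sum]
  refine Finset.sum_congr rfl fun l hl => ?_
  have hl' : l ≤ b := by simpa [Nat.lt_succ_iff] using hl
  obtain ⟨c, rfl⟩ := Nat.exists_eq_add_of_le hl'
  have e1 : l + c + 1 - 1 - l = c := by omega
  have e2 : l + c - c = l := by omega
  have e3 : (l + c).choose c = (l + c).choose l := by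
    rw [Nat.choose_symm_add]
  rw [e1, e2, e3, neg_pow (l : ℚ) m]
  have h1 : (-1 : ℚ) ^ c * (-1) ^ c = 1 := by rw [← mul_pow]; norm_num
  simp only [pow_add, pow_one]
  linear_combination (-(-1 : ℚ) ^ l * (-1) ^ m * ((l + c).choose l) * (l : ℚ) ^ m) * h1

theorem sum_residue_class_stirling_mod_p (p : ℕ) (hp : p.Prime) (hp3 : 3 ≤ p)
    (b ε : ℕ) (hb1 : 1 ≤ b) (hb2 : b ≤ p - 2) (hε : ε ≤ p - 1)
    (a m : ℕ) (ha1 : 1 ≤ a) (ha2 : a ≤ ε) (hm : 1 ≤ m) :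
    RatCong p 1
      (∑ l ∈ Finset.range (b + 1),
        (-1 : ℚ) ^ l * (-(l : ℚ)) ^ m * ((b * p + ε).choose (a + l * p) : ℚ) /
          (((b + 1 : ℕ) * p : ℚ) - (a : ℚ) - (l : ℚ) * (p : ℚ)))
      ((-1 : ℚ) ^ (b + m + 1) * (b.factorial : ℚ) * stir m b * (ε.choose a : ℚ) / (a : ℚ)) := by
  apply PGood.ratCong hp
  rw [stir_aux, Finset.sum_mul, Finset.sum_div, ← Finset.sum_sub_distrib]
  apply PGood.sum hp
  intro l _
  have hap : a < p := by omega
  obtain ⟨k, hk⟩ := choose_lucas_aux hp b ε a l (by omega) hap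
  have hk' : ((b * p + ε).choose (a + l * p) : ℚ) = b.choose l * ε.choose a + p * k := by
    exact_mod_cast hk
  have hpa : ¬ ((p : ℤ) ∣ (a : ℤ)) := by
    intro h
    exact absurd (Nat.le_of_dvd ha1 (by exact_mod_cast h)) (by omega)
  have hpD : ¬ ((p : ℤ) ∣ ((b + 1 - l) * p - a : ℤ)) := by
    intro h
    exact hpa ((dvd_sub_right (Dvd.intro_left _ rfl)).mp h)
  have ha0 : (a : ℚ) ≠ 0 := by exact_mod_cast (by omega : a ≠ 0)
  have hD0 : (((b + 1 - l) * p - a : ℤ) : ℚ) ≠ 0 := by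
    intro h0
    rw [Int.cast_eq_zero] at h0
    exact hpD (h0 ▸ dvd_zero _)
  have hDe : (((b + 1 : ℕ) * p : ℚ) - (a : ℚ) - (l : ℚ) * (p : ℚ))
      = (((b + 1 - l) * p - a : ℤ) : ℚ) := by push_cast; ring
  rw [hDe, hk']
  refine ⟨(-1) ^ l * (-l) ^ m * (k * a + b.choose l * ε.choose a * (b + 1 - l)),
    ((b + 1 - l) * p - a) * a, ?_, ?_⟩
  · intro hd
    rcases (Nat.prime_iff_prime_int.mp hp).dvd_or_dvd hd with h1 | h1
    · exact hpD h1
    · exact hpa h1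
  · generalize hD : ((b + 1 - l) * p - a : ℤ) = D at *
    have hD' : (D : ℚ) = (b + 1 - l) * p - a := by rw [← hD]; push_cast; ring
    push_cast
    field_simp
    rw [hD']
    ring
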